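/- arXiv:0807.4497 — 2 statements merged into one kernel-verified Lean document; each statement's English description precedes it below -/
import Mathlib

section
/- Let k ≥ 2, let a_1,…,a_k be nonnegative integers with at least one a_j strictly positive, and let (x_1,…,x_{k−1}) ∈ [0,1]^{k−1} be a point at which θ_s^k(x_s,…,x_{k−1}; a) ≥ 0 for every s = 1,…,k−1. Then a_1 + Σ_{s=1}^{k−1} a_{s+1}·w_{s,1}(x_1,…,x_s) > 0. -/
open Finset

/-- The 2×2 matrix `R(x)` with rows `(1−x, x)` and `(x, 1−x)`. -/
noncomputable def Rm (x : ℝ) : Matrix (Fin 2) (Fin 2) ℝ := !![1 - x, x; x, 1 - x]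

/-- The 2×2 matrix `T` with rows `(1, −1)` and `(0, 1)`. -/
noncomputable def Tm : Matrix (Fin 2) (Fin 2) ℝ := !![1, -1; 0, 1]

/-- Auxiliary product: `Maux x q n = R(x_{q+n})·T ⋯ R(x_q)·T`. -/
noncomputable def Maux (x : ℕ → ℝ) (q : ℕ) : ℕ → Matrix (Fin 2) (Fin 2) ℝ
  | 0 => Rm (x q) * Tm
  | n + 1 => Rm (x (q + n + 1)) * Tm * Maux x q n

/-- `Mpq x p q = M_{p,q}(x_q,…,x_p) = R(x_p)·T·R(x_{p−1})·T ⋯ R(x_q)·T` (for `q ≤ p`). -/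
noncomputable def Mpq (x : ℕ → ℝ) (p q : ℕ) : Matrix (Fin 2) (Fin 2) ℝ := Maux x q (p - q)

/-- `α_{p,q} = (M_{p,q})₂₂`. -/
noncomputable def alphaPQ (x : ℕ → ℝ) (p q : ℕ) : ℝ := Mpq x p q 1 1

/-- `β_{p,q} = (M_{p,q})₂₁`. -/
noncomputable def betaPQ (x : ℕ → ℝ) (p q : ℕ) : ℝ := Mpq x p q 1 0

/-- `γ_{p,q} = (M_{p,q})₁₂`. -/
noncomputable def gammaPQ (x : ℕ → ℝ) (p q : ℕ) : ℝ := Mpq x p q 0 1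

/-- `δ_{p,q} = (M_{p,q})₁₁`. -/
noncomputable def deltaPQ (x : ℕ → ℝ) (p q : ℕ) : ℝ := Mpq x p q 0 0

/-- `y_{p,q} = α_{p,q} − β_{p,q}`. -/
noncomputable def yPQ (x : ℕ → ℝ) (p q : ℕ) : ℝ := alphaPQ x p q - betaPQ x p q

/-- `w_{p,q} = α_{p,q} + β_{p,q}`. -/
noncomputable def wPQ (x : ℕ → ℝ) (p q : ℕ) : ℝ := alphaPQ x p q + betaPQ x p q

/-- `θ_s^k(x_s,…,x_{k−1}; a) = a_s + Σ_{j=s}^{k−1} a_{j+1}·y_{j,s}`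
(for `k = s` this is just `a_s`). -/
noncomputable def theta (x a : ℕ → ℝ) (k s : ℕ) : ℝ :=
  a s + ∑ j ∈ Finset.Icc s (k - 1), a (j + 1) * yPQ x j s

theorem Maux_succ_right (x : ℕ → ℝ) (q n : ℕ) :
    Maux x q (n + 1) = Maux x (q + 1) n * (Rm (x q) * Tm) := by
  induction n with
  | zero => simp [Maux]
  | succ n ih =>
    rw [Maux, ih, Maux, show q + 1 + n + 1 = q + (n + 1) + 1 by omega]
    simp only [Matrix.mul_assoc]

theorem Mpq_self (x : ℕ → ℝ) (q : ℕ) : Mpq x q q = Rm (x q) * Tm := by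
  simp [Mpq, Maux]

theorem Mpq_of_lt (x : ℕ → ℝ) {p q : ℕ} (h : q < p) :
    Mpq x p q = Mpq x p (q + 1) * (Rm (x q) * Tm) := by
  rw [Mpq, Mpq, show p - q = p - (q + 1) + 1 by omega, Maux_succ_right]

theorem betaPQ_self (x : ℕ → ℝ) (q : ℕ) : betaPQ x q q = x q := by
  simp [betaPQ, Mpq_self, Rm, Tm]

theorem alphaPQ_self (x : ℕ → ℝ) (q : ℕ) : alphaPQ x q q = 1 - 2 * x q := by
  simp [alphaPQ, Mpq_self, Rm, Tm]
  ring

theorem betaPQ_of_lt (x : ℕ → ℝ) {p q : ℕ} (h : q < p) :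
    betaPQ x p q = (1 - x q) * betaPQ x p (q + 1) + x q * alphaPQ x p (q + 1) := by
  simp [betaPQ, alphaPQ, Mpq_of_lt x h, Rm, Tm, Matrix.mul_apply, Fin.sum_univ_two]
  ring

theorem alphaPQ_of_lt (x : ℕ → ℝ) {p q : ℕ} (h : q < p) :
    alphaPQ x p q = (1 - 2 * x q) * (alphaPQ x p (q + 1) - betaPQ x p (q + 1)) := by
  simp [betaPQ, alphaPQ, Mpq_of_lt x h, Rm, Tm, Matrix.mul_apply, Fin.sum_univ_two]
  ring

/-- The first entry of the row vector `Σ_{j=s}^{k-1} a_{j+1} e₂ᵀ M_{j,s}`. -/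
noncomputable def betaSum (x a : ℕ → ℝ) (k s : ℕ) : ℝ :=
  ∑ j ∈ Icc s (k - 1), a (j + 1) * betaPQ x j s

theorem betaSum_self (x a : ℕ → ℝ) {k : ℕ} (hk : 1 ≤ k) : betaSum x a k k = 0 := by
  rw [betaSum, Icc_eq_empty (by omega), sum_empty]

theorem theta_self (x a : ℕ → ℝ) {k : ℕ} (hk : 1 ≤ k) : theta x a k k = a k := by
  rw [theta, Icc_eq_empty (by omega), sum_empty, add_zero]

theorem betaSum_of_lt (x a : ℕ → ℝ) {k s : ℕ} (h : s < k) :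
    betaSum x a k s = betaSum x a k (s + 1) + x s * theta x a k (s + 1) := by
  have hsum : ∑ j ∈ Icc (s + 1) (k - 1), a (j + 1) * betaPQ x j s =
      ∑ j ∈ Icc (s + 1) (k - 1), (a (j + 1) * betaPQ x j (s + 1) +
        x s * (a (j + 1) * yPQ x j (s + 1))) := by
    refine sum_congr rfl fun j hj => ?_
    rw [betaPQ_of_lt x (mem_Icc.1 hj).1, yPQ]
    ring
  rw [betaSum, betaSum, theta, ← add_sum_Ioc_eq_sum_Icc (by omega), ← Icc_add_one_left_eq_Ioc,
    hsum, sum_add_distrib, ← mul_sum, betaPQ_self]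
  ring

theorem theta_of_lt (x a : ℕ → ℝ) {k s : ℕ} (h : s < k) :
    theta x a k s = a s + (1 - 3 * x s) * theta x a k (s + 1) - betaSum x a k (s + 1) := by
  have hsum : ∑ j ∈ Icc (s + 1) (k - 1), a (j + 1) * yPQ x j s =
      ∑ j ∈ Icc (s + 1) (k - 1), ((1 - 3 * x s) * (a (j + 1) * yPQ x j (s + 1)) -
        a (j + 1) * betaPQ x j (s + 1)) := by
    refine sum_congr rfl fun j hj => ?_
    rw [yPQ, yPQ, betaPQ_of_lt x (mem_Icc.1 hj).1, alphaPQ_of_lt x (mem_Icc.1 hj).1]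
    ring
  rw [betaSum, theta, theta, ← add_sum_Ioc_eq_sum_Icc (by omega), ← Icc_add_one_left_eq_Ioc,
    hsum, sum_sub_distrib, ← mul_sum, yPQ, betaPQ_self, alphaPQ_self]
  ring

theorem add_sum_mul_wPQ (x a : ℕ → ℝ) (k s : ℕ) :
    a s + ∑ j ∈ Icc s (k - 1), a (j + 1) * wPQ x j s =
      theta x a k s + 2 * betaSum x a k s := by
  rw [theta, betaSum, mul_sum, add_assoc, ← sum_add_distrib]
  congr 1
  refine sum_congr rfl fun j _ => ?_
  rw [wPQ, yPQ]
  ring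

theorem betaSum_nonneg {x a : ℕ → ℝ} {k s : ℕ} (hk : 1 ≤ k) (hs : s ≤ k)
    (hx : ∀ i, s ≤ i → i < k → 0 ≤ x i) (hθ : ∀ i, s ≤ i → i ≤ k → 0 ≤ theta x a k i) :
    0 ≤ betaSum x a k s := by
  induction hs using Nat.decreasingInduction with
  | self => rw [betaSum_self x a hk]
  | of_succ s hs ih =>
    have h1 := ih (fun i hi => hx i (by omega)) (fun i hi => hθ i (by omega))
    have h2 := mul_nonneg (hx s le_rfl hs) (hθ (s + 1) (by omega) hs)
    rw [betaSum_of_lt x a hs]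
    exact add_nonneg h1 h2

/-- The row sum and the vertical eigenvalue cannot both vanish unless the weight does. -/
theorem weight_eq_zero_of_theta_eq_zero {x a : ℕ → ℝ} {k s : ℕ} (hk : 1 ≤ k) (hs : s ≤ k)
    (ha : ∀ i, s ≤ i → 0 ≤ a i) (hx : ∀ i, s ≤ i → i < k → 0 ≤ x i)
    (hθ : ∀ i, s ≤ i → i ≤ k → 0 ≤ theta x a k i)
    (hb : betaSum x a k s = 0) (ht : theta x a k s = 0) :
    ∀ j, s ≤ j → j ≤ k → a j = 0 := by
  induction hs using Nat.decreasingInduction with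
  | self =>
    intro j hj hjk
    rw [le_antisymm hjk hj, ← theta_self x a hk, ht]
  | of_succ s hs ih =>
    have hx' : ∀ i, s + 1 ≤ i → i < k → 0 ≤ x i := fun i hi => hx i (by omega)
    have hθ' : ∀ i, s + 1 ≤ i → i ≤ k → 0 ≤ theta x a k i := fun i hi => hθ i (by omega)
    have h1 := betaSum_nonneg hk hs hx' hθ'
    have h2 := hθ (s + 1) (by omega) hs
    have h3 := mul_nonneg (hx s le_rfl hs) h2
    have h4 := ha s le_rfl
    rw [betaSum_of_lt x a hs] at hb
    rw [theta_of_lt x a hs] at ht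
    intro j hj hjk
    rcases hj.eq_or_lt with rfl | hj
    · linarith
    · exact ih (fun i hi => ha i (by omega)) hx' hθ' (by linarith) (by linarith) j hj hjk

/-- If the vertical eigenvalues θ_s^k are nonnegative at a point of the cube and the
weight consists of nonnegative integers, one of them positive, then the trace term
`a_1 + Σ a_{s+1} w_{s,1}` is positive. -/
theorem stmt1 (k : ℕ) (hk : 2 ≤ k) (a : ℕ → ℕ)
    (ha : ∃ j, 1 ≤ j ∧ j ≤ k ∧ 0 < a j)
    (x : ℕ → ℝ) (hx : ∀ i, 1 ≤ i → i ≤ k - 1 → x i ∈ Set.Icc (0 : ℝ) 1)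
    (hθ : ∀ s, 1 ≤ s → s ≤ k - 1 → 0 ≤ theta x (fun j => (a j : ℝ)) k s) :
    0 < (a 1 : ℝ) + ∑ s ∈ Finset.Icc 1 (k - 1), (a (s + 1) : ℝ) * wPQ x s 1 := by
  have hx' : ∀ i, 1 ≤ i → i < k → 0 ≤ x i := fun i hi hik => (hx i hi (by omega)).1
  have hθ' : ∀ i, 1 ≤ i → i ≤ k → 0 ≤ theta x (fun j => (a j : ℝ)) k i := by
    intro i hi hik
    rcases hik.eq_or_lt with rfl | hik
    · rw [theta_self _ _ hi]
      positivity
    · exact hθ i hi (by omega)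
  have hb := betaSum_nonneg (by omega) (by omega) hx' hθ'
  have ht := hθ' 1 le_rfl (by omega)
  rw [add_sum_mul_wPQ x (fun j => (a j : ℝ)) k 1]
  by_contra! hneg
  obtain ⟨j, hj, hjk, hpos⟩ := ha
  have hzero := weight_eq_zero_of_theta_eq_zero (by omega) (by omega)
    (fun i _ => Nat.cast_nonneg (a i)) hx' hθ' (by linarith) (by linarith) j hj hjk
  exact hpos.ne' (Nat.cast_eq_zero.1 hzero)
end

section
/- For every integer j ≥ 1 and all real numbers x_1,…,x_j, setting the last variable equal to 1 one has y_{j+1,1}(x_1,…,x_j,1) = −1 − 2·y_{j,1}(x_1,…,x_j) − Σ_{h=1}^{j−1} y_{h,1}(x_1,…,x_h). -/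
open Finset

theorem Mpq_succ (x : ℕ → ℝ) {p q : ℕ} (h : q ≤ p) :
    Mpq x (p + 1) q = Rm (x (p + 1)) * Tm * Mpq x p q := by
  obtain ⟨n, rfl⟩ := Nat.exists_eq_add_of_le h
  simp [Mpq, Nat.add_assoc, Maux]

theorem yPQ_succ (x : ℕ → ℝ) {p q : ℕ} (h : q ≤ p) :
    yPQ x (p + 1) q =
      x (p + 1) * (gammaPQ x p q - deltaPQ x p q) + (1 - 2 * x (p + 1)) * yPQ x p q := by
  simp [yPQ, alphaPQ, betaPQ, gammaPQ, deltaPQ, Mpq_succ x h, Rm, Tm, Matrix.mul_apply,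
    Fin.sum_univ_two]
  ring

/-- Multiplication by `R(x)` preserves column sums, so the difference of the first-row entries
telescopes. -/
theorem gammaPQ_sub_deltaPQ (x : ℕ → ℝ) {p q : ℕ} (h : q ≤ p) :
    gammaPQ x p q - deltaPQ x p q = -1 - ∑ i ∈ Finset.Icc q p, yPQ x i q := by
  induction p, h using Nat.le_induction with
  | base =>
    simp [yPQ, alphaPQ, betaPQ, gammaPQ, deltaPQ, Mpq_self, Rm, Tm]
    ring
  | succ p h ih =>
    have column_sums : gammaPQ x (p + 1) q - deltaPQ x (p + 1) q + yPQ x (p + 1) q =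
        gammaPQ x p q - deltaPQ x p q := by
      simp [yPQ, alphaPQ, betaPQ, gammaPQ, deltaPQ, Mpq_succ x h, Rm, Tm, Matrix.mul_apply,
        Fin.sum_univ_two]
      ring
    rw [Finset.sum_Icc_succ_top (by omega)]
    linarith

/-- Setting the last variable to 1:
`y_{j+1,1}(…,1) = −1 − 2 y_{j,1} − Σ_{h=1}^{j−1} y_{h,1}`. -/
theorem stmt6 (j : ℕ) (hj : 1 ≤ j) (x : ℕ → ℝ) (hx : x (j + 1) = 1) :
    yPQ x (j + 1) 1 = -1 - 2 * yPQ x j 1 - ∑ h ∈ Finset.Icc 1 (j - 1), yPQ x h 1 := by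
  obtain ⟨n, rfl⟩ := Nat.exists_eq_add_of_le' hj
  rw [yPQ_succ x hj, hx, gammaPQ_sub_deltaPQ x hj, Finset.sum_Icc_succ_top (by omega),
    Nat.add_sub_cancel]
  ring
end
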